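/- If P ⊆ B(n) is a maximal intersecting family and p ∈ min(P), then p = π(ID(p)). -/

import Mathlib

/-- The inversion set of a permutation `p` of `{0,…,n-1}` (0-indexed version of
`Inv(p) = {(p_j, p_i) : i < j, p_j < p_i}`): pairs `(a, b)` of values with `a < b`
such that `b` precedes `a` in the one-line notation of `p`. -/
def InvSet (n : ℕ) (p : Equiv.Perm (Fin n)) : Finset (Fin n × Fin n) :=
  Finset.univ.filter (fun x => x.1 < x.2 ∧ p.symm x.2 < p.symm x.1)

/-- The weak (right) Bruhat order: `p ≼ q` iff `Inv(p) ⊆ Inv(q)`. -/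
def BLE {n : ℕ} (p q : Equiv.Perm (Fin n)) : Prop :=
  InvSet n p ⊆ InvSet n q

/-- The rank of a permutation in the weak Bruhat order: `rank(p) = |Inv(p)|`. -/
def brank (n : ℕ) (p : Equiv.Perm (Fin n)) : ℕ :=
  (InvSet n p).card

/-- The inverse descent set `ID(p) ⊆ {1,…,n-1}`: `i ∈ ID(p)` iff the (1-indexed)
value `i+1` precedes the value `i` in the one-line notation of `p`.  Here the
1-indexed value `v ∈ {1,…,n}` corresponds to the element of `Fin n` with `val = v - 1`. -/
def ID (n : ℕ) (p : Equiv.Perm (Fin n)) : Finset ℕ :=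
  (Finset.Icc 1 (n - 1)).filter
    (fun i => ∃ a b : Fin n, (a : ℕ) + 1 = i ∧ (b : ℕ) = i ∧ p.symm b < p.symm a)

/-- The generator `g i` is the adjacent transposition interchanging the
(1-indexed) values `i` and `i+1`. -/
def g (n i : ℕ) : Equiv.Perm (Fin n) :=
  if h : 1 ≤ i ∧ i < n then Equiv.swap ⟨i - 1, by omega⟩ ⟨i, h.2⟩ else 1

/-- A family of permutations is intersecting if any two of its members have
meet different from the identity in the weak Bruhat lattice; equivalently (since the
identity is the minimum), any two members have a common lower bound distinct
from the identity. -/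
def BInter (n : ℕ) (P : Set (Equiv.Perm (Fin n))) : Prop :=
  ∀ p ∈ P, ∀ q ∈ P, ∃ r : Equiv.Perm (Fin n), r ≠ 1 ∧ BLE r p ∧ BLE r q

/-- A maximal intersecting family: intersecting, and every permutation
intersecting all its members belongs to it. -/
def MaxBInter (n : ℕ) (P : Set (Equiv.Perm (Fin n))) : Prop :=
  BInter n P ∧ ∀ q : Equiv.Perm (Fin n),
    (∀ p ∈ P, ∃ r : Equiv.Perm (Fin n), r ≠ 1 ∧ BLE r q ∧ BLE r p) → q ∈ P

/-- The set of `≼`-minimal elements of a family `P`. -/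
def minSet (n : ℕ) (P : Set (Equiv.Perm (Fin n))) : Set (Equiv.Perm (Fin n)) :=
  {p | p ∈ P ∧ ∀ q ∈ P, BLE q p → q = p}

/-- `m` is the meet (greatest lower bound) of `p` and `q` in the weak Bruhat order. -/
def IsMeetB (n : ℕ) (p q m : Equiv.Perm (Fin n)) : Prop :=
  BLE m p ∧ BLE m q ∧ ∀ r, BLE r p → BLE r q → BLE r m

/-- `m` is the join (least upper bound) of the set `S` in the weak Bruhat order. -/
def IsLUBB (n : ℕ) (S : Set (Equiv.Perm (Fin n))) (m : Equiv.Perm (Fin n)) : Prop :=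
  (∀ s ∈ S, BLE s m) ∧ ∀ u, (∀ s ∈ S, BLE s u) → BLE m u

/-- For a system `𝒜` of subsets of `{1,…,n-1}`,
`P(𝒜) = {p : A ⊆ ID(p) for some A ∈ 𝒜}`. -/
def PofSystem (n : ℕ) (𝒜 : Set (Finset ℕ)) : Set (Equiv.Perm (Fin n)) :=
  {p | ∃ A ∈ 𝒜, A ⊆ ID n p}

/-- The generating set system of a family `P`: `{ID(p) : p ∈ min(P)}`. -/
def genSys (n : ℕ) (P : Set (Equiv.Perm (Fin n))) : Set (Finset ℕ) :=
  {A | ∃ p ∈ minSet n P, ID n p = A}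

/-- A maximal intersecting antichain of subsets of `{1,…,n-1}`: an antichain
under inclusion, any two members of which meet, such that for every subset `B`
of `{1,…,n-1}` not in the system there is a member `A` with `A ∩ B = ∅` or `A ⊆ B`. -/
def MIA (n : ℕ) (𝒜 : Set (Finset ℕ)) : Prop :=
  (∀ A ∈ 𝒜, ∀ B ∈ 𝒜, A ⊆ B → A = B) ∧
  (∀ A ∈ 𝒜, ∀ B ∈ 𝒜, (A ∩ B).Nonempty) ∧
  (∀ B : Finset ℕ, B ⊆ Finset.Icc 1 (n - 1) → B ∉ 𝒜 → ∃ A ∈ 𝒜, A ∩ B = ∅ ∨ A ⊆ B)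

theorem mem_invSet {n : ℕ} {p : Equiv.Perm (Fin n)} {a b : Fin n} :
    (a, b) ∈ InvSet n p ↔ a < b ∧ p.symm b < p.symm a := by
  simp [InvSet]

theorem succ_mem_ID {n : ℕ} {p : Equiv.Perm (Fin n)} {a : ℕ} (h : a + 1 < n) :
    a + 1 ∈ ID n p ↔ p.symm ⟨a + 1, h⟩ < p.symm ⟨a, by omega⟩ := by
  simp only [ID, Finset.mem_filter, Finset.mem_Icc]
  constructor
  · rintro ⟨-, x, y, hx, hy, hlt⟩
    have hxa : x = ⟨a, by omega⟩ := Fin.ext (Nat.succ.inj hx)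
    have hya : y = ⟨a + 1, h⟩ := Fin.ext hy
    rwa [← hxa, ← hya]
  · exact fun hlt => ⟨by omega, _, _, rfl, rfl, hlt⟩

theorem exists_eq_succ_of_mem_ID {n : ℕ} {p : Equiv.Perm (Fin n)} {i : ℕ} (hi : i ∈ ID n p) :
    ∃ a, i = a + 1 ∧ a + 1 < n := by
  simp only [ID, Finset.mem_filter, Finset.mem_Icc] at hi
  exact ⟨i - 1, by omega, by omega⟩

theorem ID_mono {n : ℕ} {p q : Equiv.Perm (Fin n)} (h : BLE p q) : ID n p ⊆ ID n q := by
  intro i hi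
  obtain ⟨a, rfl, ha⟩ := exists_eq_succ_of_mem_ID hi
  rw [succ_mem_ID ha] at hi ⊢
  exact (mem_invSet.1 (h (mem_invSet.2 ⟨by simp, hi⟩))).2

theorem ID_nonempty_of_ne_one {n : ℕ} {p : Equiv.Perm (Fin n)} (hp : p ≠ 1) :
    (ID n p).Nonempty := by
  by_contra hempty
  rw [Finset.not_nonempty_iff_eq_empty] at hempty
  apply hp
  cases n with
  | zero => exact Subsingleton.elim _ _
  | succ n =>
    have hmono : StrictMono p.symm := by
      rw [Fin.strictMono_iff_lt_succ]
      intro i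
      have hi : (i : ℕ) + 1 ∉ ID (n + 1) p := by simp [hempty]
      rw [succ_mem_ID (by omega), not_lt] at hi
      exact lt_of_le_of_ne hi (p.symm.injective.ne (by simp [Fin.ext_iff]))
    have hid : ⇑p.symm = id := (hmono.range_inj strictMono_id).1
      (by rw [p.symm.surjective.range_eq, Set.range_id])
    rw [← p.symm_symm, show p.symm = 1 from Equiv.ext (congrFun hid)]
    rfl

theorem invSet_g {n a : ℕ} (h : a + 1 < n) :
    InvSet n (g n (a + 1)) = {(⟨a, by omega⟩, ⟨a + 1, h⟩)} := by
  have hg : g n (a + 1) = Equiv.swap ⟨a, by omega⟩ ⟨a + 1, h⟩ := by simp [g, h]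
  ext ⟨x, y⟩
  rw [mem_invSet, hg, Equiv.symm_swap, Finset.mem_singleton, Prod.mk.injEq]
  simp only [Equiv.swap_apply_def]
  split_ifs <;> simp only [Fin.ext_iff, Fin.lt_def] at * <;> omega

theorem g_ble_iff {n a : ℕ} (h : a + 1 < n) {p : Equiv.Perm (Fin n)} :
    BLE (g n (a + 1)) p ↔ a + 1 ∈ ID n p := by
  rw [BLE, invSet_g h, Finset.singleton_subset_iff, mem_invSet, succ_mem_ID h]
  simp

theorem g_ne_one {n a : ℕ} (h : a + 1 < n) : g n (a + 1) ≠ 1 := by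
  simp [g, h]

theorem exists_ne_one_ble_iff {n : ℕ} {p q : Equiv.Perm (Fin n)} :
    (∃ r : Equiv.Perm (Fin n), r ≠ 1 ∧ BLE r p ∧ BLE r q) ↔ (ID n p ∩ ID n q).Nonempty := by
  constructor
  · rintro ⟨r, hr, hrp, hrq⟩
    exact (ID_nonempty_of_ne_one hr).mono (Finset.subset_inter (ID_mono hrp) (ID_mono hrq))
  · rintro ⟨i, hi⟩
    rw [Finset.mem_inter] at hi
    obtain ⟨a, rfl, ha⟩ := exists_eq_succ_of_mem_ID hi.1
    exact ⟨_, g_ne_one ha, (g_ble_iff ha).2 hi.1, (g_ble_iff ha).2 hi.2⟩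

/-- The number of `i ∉ D` with `1 ≤ i ≤ a`: values `a < b` have the same index exactly when
all of `a + 1, …, b` lie in `D`. -/
def blockIndex (D : Finset ℕ) (a : ℕ) : ℕ :=
  Nat.count (fun i => i + 1 ∉ D) a

theorem blockIndex_mono (D : Finset ℕ) : Monotone (blockIndex D) :=
  Nat.count_monotone _

theorem blockIndex_succ_eq_iff {D : Finset ℕ} {a : ℕ} :
    blockIndex D a = blockIndex D (a + 1) ↔ a + 1 ∈ D := by
  simp [blockIndex, Nat.count_succ]

/-- Values in one block of `D` are reversed in every permutation whose inverse descent set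
contains `D`. -/
theorem symm_lt_symm_of_blockIndex_eq {n : ℕ} {u : Equiv.Perm (Fin n)} {D : Finset ℕ}
    (hD : D ⊆ ID n u) {a b : Fin n} (hab : a < b)
    (heq : blockIndex D a = blockIndex D b) : u.symm b < u.symm a := by
  obtain ⟨a, ha⟩ := a
  obtain ⟨b, hb⟩ := b
  simp only [Fin.mk_lt_mk] at hab heq
  induction b, (hab : a + 1 ≤ b) using Nat.le_induction with
  | base => exact (succ_mem_ID hb).1 (hD (blockIndex_succ_eq_iff.1 heq))
  | succ b hle ih =>
    have h₁ := blockIndex_mono D (show a ≤ b by omega)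
    have h₂ := blockIndex_mono D (Nat.le_succ b)
    have hstep : b + 1 ∈ ID n u := hD (blockIndex_succ_eq_iff.1 (by grind))
    exact ((succ_mem_ID hb).1 hstep).trans (ih (by omega) (by grind))

/-- The permutation reversing each block of `D`. -/
theorem exists_perm_reversing_blocks (n : ℕ) (D : Finset ℕ) :
    ∃ m : Equiv.Perm (Fin n), ∀ a b : Fin n, a < b →
      (m.symm b < m.symm a ↔ blockIndex D a = blockIndex D b) := by
  let key : Fin n → ℕ ×ₗ ℕᵒᵈ := fun a => toLex (blockIndex D a, OrderDual.toDual (a : ℕ))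
  have hinj : Function.Injective key := fun a b h => by
    simpa [key, Fin.ext_iff] using (congrArg (fun x => (ofLex x).2) h)
  have hmono : StrictMono (key ∘ Tuple.sort key) :=
    (Tuple.monotone_sort key).strictMono_of_injective (hinj.comp (Tuple.sort key).injective)
  refine ⟨Tuple.sort key, fun a b hab => ?_⟩
  rw [← hmono.lt_iff_lt]
  have hle := blockIndex_mono D hab.le
  simp only [Function.comp_apply, Equiv.apply_symm_apply, key, Prod.Lex.toLex_lt_toLex,
    OrderDual.toDual_lt_toDual]
  have : (a : ℕ) < b := hab
  omega

/-- If `P` is a maximal intersecting family in `B(n)` and `p ∈ min(P)`, then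
`p = π(ID(p))`, i.e. `p` is the join of the generators indexed by `ID(p)`. -/
theorem stmt_7 (n : ℕ) (P : Set (Equiv.Perm (Fin n))) (hP : MaxBInter n P)
    (p : Equiv.Perm (Fin n)) (hp : p ∈ minSet n P) :
    IsLUBB n {s | ∃ i ∈ ID n p, s = g n i} p := by
  obtain ⟨m, hm⟩ := exists_perm_reversing_blocks n (ID n p)
  have hle : ∀ u : Equiv.Perm (Fin n), ID n p ⊆ ID n u → BLE m u := by
    rintro u hu ⟨a, b⟩ hab
    rw [mem_invSet] at hab ⊢
    exact ⟨hab.1, symm_lt_symm_of_blockIndex_eq hu hab.1 ((hm a b hab.1).1 hab.2)⟩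
  have hID : ID n p ⊆ ID n m := by
    intro i hi
    obtain ⟨a, rfl, ha⟩ := exists_eq_succ_of_mem_ID hi
    rw [succ_mem_ID ha, hm _ _ (by simp)]
    exact blockIndex_succ_eq_iff.2 hi
  have hmP : m ∈ P := hP.2 m fun q hq => exists_ne_one_ble_iff.2 <|
    (exists_ne_one_ble_iff.1 (hP.1 p hp.1 q hq)).mono (Finset.inter_subset_inter_right hID)
  obtain rfl : m = p := hp.2 m hmP (hle p subset_rfl)
  constructor
  · rintro _ ⟨i, hi, rfl⟩
    obtain ⟨a, rfl, ha⟩ := exists_eq_succ_of_mem_ID hi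
    exact (g_ble_iff ha).2 hi
  · intro u hu
    refine hle u fun i hi => ?_
    obtain ⟨a, rfl, ha⟩ := exists_eq_succ_of_mem_ID hi
    exact (g_ble_iff ha).1 (hu _ ⟨_, hi, rfl⟩)
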